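/- arXiv:2312.05937 — 5 statements merged into one kernel-verified Lean document; each statement's English description precedes it below -/
import Mathlib

section
/- Let L > 0, let J : [0,L] → Matrix (Fin 6) (Fin n) ℝ and M_a : [0,L] → Matrix (Fin 6) (Fin 6) ℝ be continuous, and let v ∈ ℝⁿ. For X ∈ [0,L] write η(X) = J(X) v ∈ ℝ⁶ and let ad_{η(X)} be the se(3) adjoint block matrix of η(X). Then vᵀ (∫₀ᴸ J(X)ᵀ ad_{η(X)}ᵀ M_a(X) J(X) dX) v = 0; that is, the quadratic form of the Coriolis matrix C₁(q, q̇) := ∫₀ᴸ Jᵀ ad*_{Jq̇} M_a J dX at q̇ = v vanishes. -/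
open Matrix

/-- The cross-product (hat) matrix of `a ∈ ℝ³`: the skew-symmetric matrix with
`hat a *ᵥ x = a × x`. -/
def hat (a : Fin 3 → ℝ) : Matrix (Fin 3) (Fin 3) ℝ :=
  !![0, -a 2, a 1; a 2, 0, -a 0; -a 1, a 0, 0]

/-- The se(3) adjoint of the twist `ξ = (ω, ν) ∈ ℝ⁶`: the 6×6 block matrix
`ad_ξ = [[ω̂, 0], [ν̂, ω̂]]`, realized with `Fin 6` indexing via
`finSumFinEquiv : Fin 3 ⊕ Fin 3 ≃ Fin 6`. -/
def se3ad (ω ν : Fin 3 → ℝ) : Matrix (Fin 6) (Fin 6) ℝ :=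
  Matrix.reindex finSumFinEquiv finSumFinEquiv
    (Matrix.fromBlocks (hat ω) 0 (hat ν) (hat ω))

/-- The se(3) adjoint of a twist `η ∈ ℝ⁶`, with angular part the first three
components and linear part the last three. -/
def se3adVec (η : Fin 6 → ℝ) : Matrix (Fin 6) (Fin 6) ℝ :=
  se3ad (fun i => η (Fin.castAdd 3 i)) (fun i => η (Fin.natAdd 3 i))

theorem se3adVec_mulVec_self (η : Fin 6 → ℝ) : se3adVec η *ᵥ η = 0 := by
  have hη : se3adVec η =
      !![0, -η 2, η 1, 0, 0, 0;
         η 2, 0, -η 0, 0, 0, 0;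
         -η 1, η 0, 0, 0, 0, 0;
         0, -η 5, η 4, 0, -η 2, η 1;
         η 5, 0, -η 3, η 2, 0, -η 0;
         -η 4, η 3, 0, -η 1, η 0, 0] := by
    ext i j
    fin_cases i <;> fin_cases j <;> rfl
  rw [hη]
  ext i
  fin_cases i <;> simp [Matrix.mulVec, dotProduct, Fin.sum_univ_six] <;> ring

theorem continuous_se3adVec : Continuous se3adVec := by
  have hat_continuous : Continuous hat := by
    refine continuous_matrix fun i j => ?_
    fin_cases i <;> fin_cases j <;> simp [hat] <;> fun_prop
  have hω : Continuous fun η : Fin 6 → ℝ => hat fun i => η (Fin.castAdd 3 i) :=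
    hat_continuous.comp (by fun_prop)
  have hν : Continuous fun η : Fin 6 → ℝ => hat fun i => η (Fin.natAdd 3 i) :=
    hat_continuous.comp (by fun_prop)
  exact (hω.matrix_fromBlocks continuous_const hν hω).matrix_reindex _ _

/-- A quadratic form commutes with the entrywise integral of its matrix. -/
theorem dotProduct_of_intervalIntegral_mulVec {ι : Type*} [Fintype ι] {a b : ℝ}
    {A : ℝ → Matrix ι ι ℝ}
    (hA : ∀ i j, IntervalIntegrable (fun X => A X i j) MeasureTheory.volume a b) (v : ι → ℝ) :
    v ⬝ᵥ ((Matrix.of fun i j => ∫ X in a..b, A X i j) *ᵥ v) =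
      ∫ X in a..b, v ⬝ᵥ (A X *ᵥ v) := by
  simp only [dotProduct, Matrix.mulVec, Matrix.of_apply, Finset.mul_sum]
  have hrow : ∀ i, IntervalIntegrable (fun X => ∑ j, v i * (A X i j * v j))
      MeasureTheory.volume a b := fun i => by
    simpa only [Finset.sum_fn] using
      IntervalIntegrable.sum Finset.univ fun j _ => ((hA i j).mul_const (v j)).const_mul (v i)
  rw [intervalIntegral.integral_finsetSum fun i _ => hrow i]
  refine Finset.sum_congr rfl fun i _ => ?_
  rw [intervalIntegral.integral_finsetSum fun j _ => ((hA i j).mul_const _).const_mul _]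
  simp

/-- The quadratic form of the Coriolis matrix
`C₁ = ∫₀ᴸ J(X)ᵀ ad*_{J(X)v} M_a(X) J(X) dX` (entrywise integral, with
`ad* = adᵀ`) at joint velocity `q̇ = v` vanishes. -/
theorem coriolis_quadratic_form_zero
    (n : ℕ) (L : ℝ) (hL : 0 < L)
    (J : ℝ → Matrix (Fin 6) (Fin n) ℝ)
    (Ma : ℝ → Matrix (Fin 6) (Fin 6) ℝ)
    (hJ : ContinuousOn J (Set.Icc 0 L))
    (hMa : ContinuousOn Ma (Set.Icc 0 L))
    (v : Fin n → ℝ) :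
    v ⬝ᵥ ((Matrix.of fun i j => ∫ X in (0 : ℝ)..L,
        ((J X)ᵀ * (se3adVec (J X *ᵥ v))ᵀ * Ma X * J X) i j) *ᵥ v) = 0 := by
  have had : ContinuousOn (fun X => se3adVec (J X *ᵥ v)) (Set.Icc 0 L) :=
    continuous_se3adVec.comp_continuousOn
      ((Continuous.matrix_mulVec continuous_id continuous_const).comp_continuousOn hJ)
  have hcont : ContinuousOn
      (fun X => (J X)ᵀ * (se3adVec (J X *ᵥ v))ᵀ * Ma X * J X) (Set.Icc 0 L) := by
    rw [continuousOn_iff_continuous_domRestrict] at hJ hMa had ⊢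
    exact ((hJ.matrix_transpose.matrix_mul had.matrix_transpose).matrix_mul hMa).matrix_mul hJ
  rw [dotProduct_of_intervalIntegral_mulVec fun i j => ContinuousOn.intervalIntegrable (by
    rw [Set.uIcc_of_le hL.le]
    exact (continuous_id.matrix_elem i j).comp_continuousOn hcont)]
  have hzero : ∀ X, v ⬝ᵥ (((J X)ᵀ * (se3adVec (J X *ᵥ v))ᵀ * Ma X * J X) *ᵥ v) = 0 := by
    intro X
    rw [Matrix.mul_assoc, ← Matrix.transpose_mul, ← Matrix.mulVec_mulVec,
      Matrix.dotProduct_mulVec, Matrix.vecMul_transpose, ← Matrix.mulVec_mulVec,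
      se3adVec_mulVec_self, zero_dotProduct]
  simp [hzero]
end

section
/- Let L > 0, let J, K : [0,L] → Matrix (Fin 6) (Fin n) ℝ and M_a : [0,L] → Matrix (Fin 6) (Fin 6) ℝ be continuous with M_a(X) symmetric for every X, and let v ∈ ℝⁿ. Define Ṁ := ∫₀ᴸ (K(X)ᵀ M_a(X) J(X) + J(X)ᵀ M_a(X) K(X)) dX, C₁ := ∫₀ᴸ J(X)ᵀ ad_{J(X)v}ᵀ M_a(X) J(X) dX, and C₂ := ∫₀ᴸ J(X)ᵀ M_a(X) K(X) dX. Then vᵀ (Ṁ − 2 C₁ − 2 C₂) v = 0. -/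
open Matrix

theorem hat_mulVec (a x : Fin 3 → ℝ) : hat a *ᵥ x = crossProduct a x := by
  ext i
  fin_cases i <;> simp [hat, cross_apply, mulVec, dotProduct, Fin.sum_univ_three] <;> ring

theorem se3ad_mulVec_append (ω ν x y : Fin 3 → ℝ) :
    se3ad ω ν *ᵥ Fin.append x y
      = Fin.append (crossProduct ω x) (crossProduct ν x + crossProduct ω y) := by
  have h : Fin.append x y ∘ finSumFinEquiv = Sum.elim x y := by
    ext i
    cases i with
    | inl i => exact Fin.append_left x y i
    | inr i => exact Fin.append_right x y i
  ext i
  rw [se3ad, reindex_apply, submatrix_mulVec_equiv, Equiv.symm_symm, h, fromBlocks_mulVec]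
  obtain ⟨i, rfl⟩ := (finSumFinEquiv (m := 3) (n := 3)).surjective i
  rw [Function.comp_apply, Equiv.symm_apply_apply]
  cases i with
  | inl i =>
    refine Eq.trans ?_ (Fin.append_left _ _ i).symm
    simp [hat_mulVec, Function.comp_def]
  | inr i =>
    refine Eq.trans ?_ (Fin.append_right _ _ i).symm
    simp [hat_mulVec, Function.comp_def]

theorem continuous_hat : Continuous hat := by
  refine continuous_matrix fun i j => ?_
  fin_cases i <;> fin_cases j <;> simp [hat] <;> fun_prop

/-- A bilinear form in the entrywise integral of a matrix function is the integral of the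
bilinear form. -/
theorem dotProduct_of_integral_mulVec {m n : Type*} [Fintype m] [Fintype n] {a b : ℝ}
    {A : ℝ → Matrix m n ℝ} (hA : ContinuousOn A (Set.uIcc a b)) (u : m → ℝ) (v : n → ℝ) :
    u ⬝ᵥ ((Matrix.of fun i j => ∫ X in a..b, A X i j) *ᵥ v)
      = ∫ X in a..b, u ⬝ᵥ (A X *ᵥ v) := by
  have hentry (i : m) (j : n) : ContinuousOn (fun X => A X i j) (Set.uIcc a b) :=
    (continuous_id.matrix_elem i j).comp_continuousOn hA
  simp only [dotProduct, mulVec, of_apply]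
  have hterm (i : m) (j : n) :
      IntervalIntegrable (fun X => A X i j * v j) MeasureTheory.volume a b :=
    ((hentry i j).mul continuousOn_const).intervalIntegrable
  have hrow (i : m) :
      IntervalIntegrable (fun X => u i * ∑ j, A X i j * v j) MeasureTheory.volume a b :=
    (continuousOn_const.mul <| continuousOn_finsetSum _ fun j _ =>
      (hentry i j).mul continuousOn_const).intervalIntegrable
  rw [intervalIntegral.integral_finsetSum fun i _ => hrow i]
  refine Finset.sum_congr rfl fun i _ => ?_
  rw [intervalIntegral.integral_const_mul, intervalIntegral.integral_finsetSum fun j _ => hterm i j]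
  simp only [intervalIntegral.integral_mul_const]

/-- Quadratic-form version of Property 3 (skew-symmetry) of the discrete
Cosserat dynamics: with `K(X)` playing the role of `J̇(X)`,
`Ṁ = ∫₀ᴸ (Kᵀ M_a J + Jᵀ M_a K) dX`, `C₁ = ∫₀ᴸ Jᵀ ad_{Jv}ᵀ M_a J dX` and
`C₂ = ∫₀ᴸ Jᵀ M_a K dX` (entrywise integrals), one has
`vᵀ (Ṁ − 2C₁ − 2C₂) v = 0`. -/
theorem skew_symmetry_quadratic_form
    (n : ℕ) (L : ℝ) (hL : 0 < L)
    (J K : ℝ → Matrix (Fin 6) (Fin n) ℝ)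
    (Ma : ℝ → Matrix (Fin 6) (Fin 6) ℝ)
    (hJ : ContinuousOn J (Set.Icc 0 L))
    (hK : ContinuousOn K (Set.Icc 0 L))
    (hMa : ContinuousOn Ma (Set.Icc 0 L))
    (hMaSymm : ∀ X, (Ma X).IsSymm)
    (v : Fin n → ℝ) :
    v ⬝ᵥ (((Matrix.of fun i j => ∫ X in (0 : ℝ)..L,
          ((K X)ᵀ * Ma X * J X + (J X)ᵀ * Ma X * K X) i j)
        - (2 : ℝ) • (Matrix.of fun i j => ∫ X in (0 : ℝ)..L,
          ((J X)ᵀ * (se3adVec (J X *ᵥ v))ᵀ * Ma X * J X) i j)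
        - (2 : ℝ) • (Matrix.of fun i j => ∫ X in (0 : ℝ)..L,
          ((J X)ᵀ * Ma X * K X) i j)) *ᵥ v) = 0 := by
  rw [← Set.uIcc_of_le hL.le] at hJ hK hMa
  have hC₂ : ContinuousOn (fun X => (J X)ᵀ * Ma X * K X) (Set.uIcc 0 L) := by
    rw [continuousOn_iff_continuous_domRestrict] at *
    exact (hJ.matrix_transpose.matrix_mul hMa).matrix_mul hK
  have hM : ContinuousOn (fun X => (K X)ᵀ * Ma X * J X + (J X)ᵀ * Ma X * K X)
      (Set.uIcc 0 L) := by
    refine ContinuousOn.add ?_ hC₂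
    rw [continuousOn_iff_continuous_domRestrict] at *
    exact (hK.matrix_transpose.matrix_mul hMa).matrix_mul hJ
  have hC₁ : ContinuousOn (fun X => (J X)ᵀ * (se3adVec (J X *ᵥ v))ᵀ * Ma X * J X)
      (Set.uIcc 0 L) := by
    rw [continuousOn_iff_continuous_domRestrict] at *
    exact ((hJ.matrix_transpose.matrix_mul (continuous_se3adVec.comp
      (hJ.matrix_mulVec continuous_const)).matrix_transpose).matrix_mul hMa).matrix_mul hJ
  have hC₁_zero (X : ℝ) :
      v ⬝ᵥ (((J X)ᵀ * (se3adVec (J X *ᵥ v))ᵀ * Ma X * J X) *ᵥ v) = 0 := by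
    rw [Matrix.mul_assoc, ← transpose_mul, ← mulVec_mulVec, mulVec_transpose, dotProduct_comm,
      ← dotProduct_mulVec, ← mulVec_mulVec v (se3adVec _), se3adVec_mulVec_self, dotProduct_zero]
  have hM_eq (X : ℝ) :
      v ⬝ᵥ (((K X)ᵀ * Ma X * J X + (J X)ᵀ * Ma X * K X) *ᵥ v)
        = 2 * (v ⬝ᵥ (((J X)ᵀ * Ma X * K X) *ᵥ v)) := by
    have hT : (K X)ᵀ * Ma X * J X = ((J X)ᵀ * Ma X * K X)ᵀ := by
      simp [transpose_mul, (hMaSymm X).eq, Matrix.mul_assoc]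
    rw [hT, add_mulVec, dotProduct_add, mulVec_transpose, dotProduct_comm v (v ᵥ* _),
      ← dotProduct_mulVec, two_mul]
  rw [sub_mulVec, sub_mulVec, smul_mulVec, smul_mulVec, dotProduct_sub, dotProduct_sub,
    dotProduct_smul, dotProduct_smul, dotProduct_of_integral_mulVec hM,
    dotProduct_of_integral_mulVec hC₁, dotProduct_of_integral_mulVec hC₂]
  simp [hC₁_zero, hM_eq]
end

section
/- Let L > 0, let J, K : [0,L] → Matrix (Fin m) (Fin n) ℝ, A : [0,L] → Matrix (Fin m) (Fin m) ℝ, and M_a : [0,L] → Matrix (Fin m) (Fin m) ℝ be continuous with M_a(X) symmetric for every X. Define Ṁ := ∫₀ᴸ (Kᵀ M_a J + Jᵀ (Aᵀ M_a + M_a A) J + Jᵀ M_a K) dX, C₁ := ∫₀ᴸ Jᵀ Aᵀ M_a J dX, and C₂ := ∫₀ᴸ Jᵀ M_a K dX. Then the matrix Ṁ − 2(C₁ + C₂) is skew-symmetric, i.e., (Ṁ − 2(C₁ + C₂))ᵀ = −(Ṁ − 2(C₁ + C₂)). -/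
open Matrix

/-- A product of continuous matrix-valued functions on a set is continuous there. -/
theorem continuousOn_matrix_mul {l m n : Type*} [Fintype m] {s : Set ℝ}
    {F : ℝ → Matrix l m ℝ} {G : ℝ → Matrix m n ℝ}
    (hF : ContinuousOn F s) (hG : ContinuousOn G s) :
    ContinuousOn (fun X => F X * G X) s :=
  (continuous_fst.matrix_mul continuous_snd).comp_continuousOn (hF.prodMk hG)

/-- The entries of a continuous matrix-valued function on `[a, b]` are interval integrable. -/
theorem intervalIntegrable_matrix_apply {m n : Type*} {a b : ℝ} (hab : a ≤ b)
    {F : ℝ → Matrix m n ℝ} (hF : ContinuousOn F (Set.Icc a b)) (i : m) (j : n) :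
    IntervalIntegrable (fun X => F X i j) MeasureTheory.volume a b :=
  ((continuous_id.matrix_elem i j).comp_continuousOn hF).intervalIntegrable_of_Icc hab

/-- If `S` is symmetric, the Leibniz-rule integrand is the sum of the two Coriolis integrands and
their transposes. -/
theorem leibniz_integrand_eq {m n : Type*} [Fintype m] (J K : Matrix m n ℝ)
    (A S : Matrix m m ℝ) (hS : S.IsSymm) :
    Kᵀ * S * J + Jᵀ * (Aᵀ * S + S * A) * J + Jᵀ * S * K =
      (Jᵀ * Aᵀ * S * J + (Jᵀ * Aᵀ * S * J)ᵀ) + (Jᵀ * S * K + (Jᵀ * S * K)ᵀ) := by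
  simp only [transpose_mul, transpose_transpose, hS.eq, Matrix.mul_add, Matrix.add_mul,
    Matrix.mul_assoc]
  abel

/-- Full matrix version of Property 3 (skew-symmetry) of the discrete Cosserat
dynamics: with `K(X)` playing the role of `J̇(X)`, `A(X)` the role of
`ad_{J(X)q̇}`, and the transport law `Ṁ_a = Aᵀ M_a + M_a A`, the matrix
`Ṁ − 2(C₁ + C₂)` is skew-symmetric, where
`Ṁ = ∫₀ᴸ (Kᵀ M_a J + Jᵀ (Aᵀ M_a + M_a A) J + Jᵀ M_a K) dX`,
`C₁ = ∫₀ᴸ Jᵀ Aᵀ M_a J dX`, `C₂ = ∫₀ᴸ Jᵀ M_a K dX` (entrywise integrals). -/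
theorem skew_symmetry_matrix
    (m n : ℕ) (L : ℝ) (hL : 0 < L)
    (J K : ℝ → Matrix (Fin m) (Fin n) ℝ)
    (A Ma : ℝ → Matrix (Fin m) (Fin m) ℝ)
    (hJ : ContinuousOn J (Set.Icc 0 L))
    (hK : ContinuousOn K (Set.Icc 0 L))
    (hA : ContinuousOn A (Set.Icc 0 L))
    (hMa : ContinuousOn Ma (Set.Icc 0 L))
    (hMaSymm : ∀ X, (Ma X).IsSymm) :
    ((Matrix.of fun i j => ∫ X in (0 : ℝ)..L,
        ((K X)ᵀ * Ma X * J X + (J X)ᵀ * ((A X)ᵀ * Ma X + Ma X * A X) * J X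
          + (J X)ᵀ * Ma X * K X) i j)
      - (2 : ℝ) • ((Matrix.of fun i j => ∫ X in (0 : ℝ)..L,
            ((J X)ᵀ * (A X)ᵀ * Ma X * J X) i j)
          + (Matrix.of fun i j => ∫ X in (0 : ℝ)..L,
            ((J X)ᵀ * Ma X * K X) i j)))ᵀ
    = -((Matrix.of fun i j => ∫ X in (0 : ℝ)..L,
          ((K X)ᵀ * Ma X * J X + (J X)ᵀ * ((A X)ᵀ * Ma X + Ma X * A X) * J X
            + (J X)ᵀ * Ma X * K X) i j)
        - (2 : ℝ) • ((Matrix.of fun i j => ∫ X in (0 : ℝ)..L,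
              ((J X)ᵀ * (A X)ᵀ * Ma X * J X) i j)
            + (Matrix.of fun i j => ∫ X in (0 : ℝ)..L,
              ((J X)ᵀ * Ma X * K X) i j))) := by
  have hJt : ContinuousOn (fun X => (J X)ᵀ) (Set.Icc 0 L) :=
    continuous_id.matrix_transpose.comp_continuousOn hJ
  have hAt : ContinuousOn (fun X => (A X)ᵀ) (Set.Icc 0 L) :=
    continuous_id.matrix_transpose.comp_continuousOn hA
  have hP := intervalIntegrable_matrix_apply hL.le (continuousOn_matrix_mul
    (continuousOn_matrix_mul (continuousOn_matrix_mul hJt hAt) hMa) hJ)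
  have hQ := intervalIntegrable_matrix_apply hL.le
    (continuousOn_matrix_mul (continuousOn_matrix_mul hJt hMa) hK)
  have hM (i j : Fin n) :
      (∫ X in (0 : ℝ)..L, ((K X)ᵀ * Ma X * J X
          + (J X)ᵀ * ((A X)ᵀ * Ma X + Ma X * A X) * J X + (J X)ᵀ * Ma X * K X) i j) =
        ((∫ X in (0 : ℝ)..L, ((J X)ᵀ * (A X)ᵀ * Ma X * J X) i j)
          + ∫ X in (0 : ℝ)..L, ((J X)ᵀ * (A X)ᵀ * Ma X * J X) j i)
        + ((∫ X in (0 : ℝ)..L, ((J X)ᵀ * Ma X * K X) i j)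
          + ∫ X in (0 : ℝ)..L, ((J X)ᵀ * Ma X * K X) j i) := by
    rw [← intervalIntegral.integral_add (hP i j) (hP j i),
      ← intervalIntegral.integral_add (hQ i j) (hQ j i),
      ← intervalIntegral.integral_add ((hP i j).add (hP j i)) ((hQ i j).add (hQ j i))]
    exact intervalIntegral.integral_congr fun X _ =>
      congrFun (congrFun (leibniz_integrand_eq (J X) (K X) (A X) (Ma X) (hMaSymm X)) i) j
  ext i j
  simp only [transpose_apply, Matrix.neg_apply, Matrix.sub_apply, Matrix.smul_apply,
    Matrix.add_apply (Matrix.of _), Matrix.of_apply, smul_eq_mul, hM]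
  ring
end

section
/- Let q : ℝ → ℝⁿ be twice differentiable and M : ℝ → Matrix (Fin n) (Fin n) ℝ be differentiable with M(t) symmetric for every t. Let C, D : ℝ → Matrix (Fin n) (Fin n) ℝ and u, F : ℝ → ℝⁿ, let K_p be a symmetric n×n real matrix, and q^d ∈ ℝⁿ. Assume: (i) for every t, q̇(t)ᵀ (M'(t) − 2C(t)) q̇(t) = 0 (skew-symmetry property along the trajectory); and (ii) for every t, M(t) q̈(t) = u(t) + F(t) − (C(t) + D(t)) q̇(t) (the equations of motion). Then V(t) := ½ q̇(t)ᵀ M(t) q̇(t) + ½ (q(t) − q^d)ᵀ K_p (q(t) − q^d) is differentiable and V'(t) = q̇(t)ᵀ (u(t) + F(t) + K_p (q(t) − q^d) − D(t) q̇(t)) for every t. -/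
open Matrix

theorem HasDerivAt.dotProduct_fun {ι : Type*} [Fintype ι] {v w : ℝ → ι → ℝ} {v' w' : ι → ℝ}
    {t : ℝ} (hv : HasDerivAt v v' t) (hw : HasDerivAt w w' t) :
    HasDerivAt (fun s => v s ⬝ᵥ w s) (v' ⬝ᵥ w t + v t ⬝ᵥ w') t := by
  simp only [dotProduct, ← Finset.sum_add_distrib]
  exact HasDerivAt.fun_sum fun i _ => (hasDerivAt_pi.1 hv i).mul (hasDerivAt_pi.1 hw i)

theorem HasDerivAt.mulVec_fun {ι κ : Type*} [Fintype ι] [Fintype κ] {A : ℝ → Matrix ι κ ℝ}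
    {A' : Matrix ι κ ℝ} {v : ℝ → κ → ℝ} {v' : κ → ℝ} {t : ℝ}
    (hA : ∀ i j, HasDerivAt (fun s => A s i j) (A' i j) t) (hv : HasDerivAt v v' t) :
    HasDerivAt (fun s => A s *ᵥ v s) (A' *ᵥ v t + A t *ᵥ v') t :=
  hasDerivAt_pi.2 fun i => (hasDerivAt_pi.2 (hA i)).dotProduct_fun hv

theorem Matrix.IsSymm.dotProduct_mulVec_comm {ι : Type*} [Fintype ι] {A : Matrix ι ι ℝ}
    (hA : A.IsSymm) (v w : ι → ℝ) : v ⬝ᵥ (A *ᵥ w) = w ⬝ᵥ (A *ᵥ v) := by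
  rw [dotProduct_mulVec, ← mulVec_transpose, hA.eq, dotProduct_comm]

/-- The derivative of a time-varying symmetric quadratic form along a curve. -/
theorem HasDerivAt.half_quadratic_form {ι : Type*} [Fintype ι] {A : ℝ → Matrix ι ι ℝ}
    {A' : Matrix ι ι ℝ} {v : ℝ → ι → ℝ} {v' : ι → ℝ} {t : ℝ}
    (hA : ∀ i j, HasDerivAt (fun s => A s i j) (A' i j) t) (hv : HasDerivAt v v' t)
    (hsymm : (A t).IsSymm) :
    HasDerivAt (fun s => (1 / 2) * (v s ⬝ᵥ (A s *ᵥ v s)))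
      ((1 / 2) * (v t ⬝ᵥ (A' *ᵥ v t)) + v t ⬝ᵥ (A t *ᵥ v')) t := by
  refine ((hv.dotProduct_fun (HasDerivAt.mulVec_fun hA hv)).const_mul (1 / 2)).congr_deriv ?_
  rw [dotProduct_add, hsymm.dotProduct_mulVec_comm v' (v t)]
  ring

/-- Lyapunov-derivative computation for the discrete Cosserat soft-arm dynamics
without gravity: along a twice differentiable trajectory `q` (with velocity
`q̇ = qdot` and acceleration `q̈ = qddot`), if the symmetric inertia matrix
`M(t)` satisfies the skew-symmetry property
`q̇ᵀ (Ṁ − 2C) q̇ = 0` and the equations of motion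
`M q̈ = u + F − (C + D) q̇` hold, then
`V(t) = ½ q̇ᵀ M q̇ + ½ q̃ᵀ K_p q̃` (with `q̃ = q − q^d`) is differentiable with
`V'(t) = q̇ᵀ (u + F + K_p q̃ − D q̇)`. -/
theorem lyapunov_derivative_no_gravity
    (n : ℕ)
    (q qdot qddot : ℝ → Fin n → ℝ)
    (M Mdot C D : ℝ → Matrix (Fin n) (Fin n) ℝ)
    (u F : ℝ → Fin n → ℝ)
    (Kp : Matrix (Fin n) (Fin n) ℝ) (hKp : Kp.IsSymm)
    (qd : Fin n → ℝ)
    (hq : ∀ t, HasDerivAt q (qdot t) t)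
    (hqdot : ∀ t, HasDerivAt qdot (qddot t) t)
    (hM : ∀ t i j, HasDerivAt (fun s => M s i j) (Mdot t i j) t)
    (hMsymm : ∀ t, (M t).IsSymm)
    (hskew : ∀ t, qdot t ⬝ᵥ ((Mdot t - (2 : ℝ) • C t) *ᵥ qdot t) = 0)
    (heom : ∀ t, M t *ᵥ qddot t = u t + F t - (C t + D t) *ᵥ qdot t) :
    ∀ t, HasDerivAt
      (fun s => (1 / 2) * (qdot s ⬝ᵥ (M s *ᵥ qdot s))
        + (1 / 2) * ((q s - qd) ⬝ᵥ (Kp *ᵥ (q s - qd))))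
      (qdot t ⬝ᵥ (u t + F t + Kp *ᵥ (q t - qd) - D t *ᵥ qdot t)) t := by
  intro t
  have hkin := HasDerivAt.half_quadratic_form (hM t) (hqdot t) (hMsymm t)
  have hpot := HasDerivAt.half_quadratic_form (A := fun _ => Kp) (A' := 0)
    (fun i j => hasDerivAt_const t (Kp i j)) ((hq t).sub_const qd) hKp
  refine (hkin.add hpot).congr_deriv ?_
  have hs := hskew t
  rw [heom t, hKp.dotProduct_mulVec_comm _ (qdot t)]
  simp only [sub_mulVec, add_mulVec, smul_mulVec, zero_mulVec, dotProduct_add, dotProduct_sub,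
    dotProduct_smul, dotProduct_zero, smul_eq_mul] at hs ⊢
  linarith
end

section
/- Let q : ℝ → ℝⁿ be twice differentiable, M : ℝ → Matrix (Fin n) (Fin n) ℝ differentiable with M(t) symmetric, C, D : ℝ → Matrix (Fin n) (Fin n) ℝ with D(t) positive semidefinite, F, g : ℝ → ℝⁿ (tip-load and gravity/buoyancy generalized forces), K_p symmetric, K_D symmetric positive definite, and q^d ∈ ℝⁿ. Assume for every t: (i) q̇(t)ᵀ (M'(t) − 2C(t)) q̇(t) = 0, and (ii) the dynamics M(t) q̈(t) = u(t) + F(t) + g(t) − (C(t) + D(t)) q̇(t) with the gravity/buoyancy-compensated control law u(t) = −K_p (q(t) − q^d) − K_D q̇(t) − F(t) − g(t). Then V(t) := ½ q̇ᵀ M q̇ + ½ (q − q^d)ᵀ K_p (q − q^d) satisfies V'(t) = −q̇(t)ᵀ (K_D + D(t)) q̇(t) ≤ 0 for every t. -/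
open Matrix

section QuadraticForm

variable {m ι : Type*} [Fintype ι] {t : ℝ}

theorem HasDerivAt.dotProduct {x y : ℝ → ι → ℝ} {x' y' : ι → ℝ}
    (hx : HasDerivAt x x' t) (hy : HasDerivAt y y' t) :
    HasDerivAt (fun s => x s ⬝ᵥ y s) (x' ⬝ᵥ y t + x t ⬝ᵥ y') t := by
  simp only [_root_.dotProduct, ← Finset.sum_add_distrib]
  exact HasDerivAt.fun_sum fun i _ => (hasDerivAt_pi.1 hx i).mul (hasDerivAt_pi.1 hy i)

theorem HasDerivAt.mulVec [Fintype m] {A : ℝ → Matrix m ι ℝ} {A' : Matrix m ι ℝ}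
    {x : ℝ → ι → ℝ} {x' : ι → ℝ}
    (hA : ∀ i j, HasDerivAt (fun s => A s i j) (A' i j) t) (hx : HasDerivAt x x' t) :
    HasDerivAt (fun s => A s *ᵥ x s) (A' *ᵥ x t + A t *ᵥ x') t :=
  hasDerivAt_pi.2 fun i => (hasDerivAt_pi.2 (hA i)).dotProduct hx

/-- The derivative of `xᵀ A x` along a curve, for `A` symmetric at the base point. -/
theorem HasDerivAt.dotProduct_mulVec_self {A : ℝ → Matrix ι ι ℝ} {A' : Matrix ι ι ℝ}
    {x : ℝ → ι → ℝ} {x' : ι → ℝ} (hsymm : (A t).IsSymm)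
    (hA : ∀ i j, HasDerivAt (fun s => A s i j) (A' i j) t) (hx : HasDerivAt x x' t) :
    HasDerivAt (fun s => x s ⬝ᵥ (A s *ᵥ x s))
      (2 * (x t ⬝ᵥ (A t *ᵥ x')) + x t ⬝ᵥ (A' *ᵥ x t)) t := by
  have h : x' ⬝ᵥ (A t *ᵥ x t) = x t ⬝ᵥ (A t *ᵥ x') := by
    rw [dotProduct_mulVec, ← mulVec_transpose, hsymm.eq, dotProduct_comm]
  convert hx.dotProduct (HasDerivAt.mulVec hA hx) using 1
  rw [h, dotProduct_add]
  ring

end QuadraticForm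

/-- Gravity/buoyancy-compensated control: with the control law
`u = −K_p q̃ − K_D q̇ − F − g` exactly cancelling the tip-load wrench `F` and
the gravity/buoyancy force `g` in the dynamics
`M q̈ = u + F + g − (C + D) q̇`, the Lyapunov function
`V(t) = ½ q̇ᵀ M q̇ + ½ q̃ᵀ K_p q̃` satisfies
`V'(t) = −q̇ᵀ (K_D + D) q̇ ≤ 0`. -/
theorem lyapunov_decrease_gravity_compensated
    (n : ℕ)
    (q qdot qddot : ℝ → Fin n → ℝ)
    (M Mdot C D : ℝ → Matrix (Fin n) (Fin n) ℝ)
    (u F g : ℝ → Fin n → ℝ)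
    (Kp KD : Matrix (Fin n) (Fin n) ℝ)
    (hKp : Kp.IsSymm) (hKD : KD.PosDef)
    (qd : Fin n → ℝ)
    (hq : ∀ t, HasDerivAt q (qdot t) t)
    (hqdot : ∀ t, HasDerivAt qdot (qddot t) t)
    (hM : ∀ t i j, HasDerivAt (fun s => M s i j) (Mdot t i j) t)
    (hMsymm : ∀ t, (M t).IsSymm)
    (hD : ∀ t, (D t).PosSemidef)
    (hskew : ∀ t, qdot t ⬝ᵥ ((Mdot t - (2 : ℝ) • C t) *ᵥ qdot t) = 0)
    (heom : ∀ t, M t *ᵥ qddot t = u t + F t + g t - (C t + D t) *ᵥ qdot t)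
    (hu : ∀ t, u t = -(Kp *ᵥ (q t - qd)) - KD *ᵥ qdot t - F t - g t) :
    ∀ t, HasDerivAt
      (fun s => (1 / 2) * (qdot s ⬝ᵥ (M s *ᵥ qdot s))
        + (1 / 2) * ((q s - qd) ⬝ᵥ (Kp *ᵥ (q s - qd))))
      (-(qdot t ⬝ᵥ ((KD + D t) *ᵥ qdot t))) t
      ∧ -(qdot t ⬝ᵥ ((KD + D t) *ᵥ qdot t)) ≤ 0 := by
  intro t
  constructor
  · have hkin := HasDerivAt.dotProduct_mulVec_self (hMsymm t) (hM t) (hqdot t)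
    have hpot := HasDerivAt.dotProduct_mulVec_self (A := fun _ => Kp) (A' := 0) hKp
      (fun i j => hasDerivAt_const t (Kp i j)) ((hq t).sub_const qd)
    refine ((hkin.const_mul (1 / 2)).add (hpot.const_mul (1 / 2))).congr_deriv ?_
    have hKp_comm : (q t - qd) ⬝ᵥ (Kp *ᵥ qdot t) = qdot t ⬝ᵥ (Kp *ᵥ (q t - qd)) := by
      rw [dotProduct_mulVec, ← mulVec_transpose, hKp.eq, dotProduct_comm]
    have hs := hskew t
    rw [heom t, hu t, hKp_comm]
    simp only [sub_mulVec, add_mulVec, smul_mulVec, zero_mulVec, dotProduct_sub, dotProduct_add,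
      dotProduct_neg, dotProduct_smul, dotProduct_zero, smul_eq_mul] at hs ⊢
    linarith
  · simpa using (hKD.posSemidef.add (hD t)).dotProduct_mulVec_nonneg (qdot t)
end
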